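/- Let (A,d) be a compact positive definite metric space and suppose a finite signed Borel measure μ on A with Z_A(μ,μ) ≠ 0 achieves the supremum defining the magnitude, i.e., μ(A)² / Z_A(μ,μ) = sup{ ν(A)² / Z_A(ν,ν) : ν a finite signed Borel measure on A with Z_A(ν,ν) ≠ 0 }. Then μ is a nonzero scalar multiple of a weight measure for A: there exists c ≠ 0 such that ∫_A e^{−d(x,y)} d(c·μ)(y) = 1 for every x ∈ A. -/

import Mathlib

open MeasureTheory Metric
open scoped ENNReal

/-- Integral of a real-valued function against a finite signed Borel measure. -/
noncomputable def sInt {A : Type*} [MeasurableSpace A] (μ : SignedMeasure A) (f : A → ℝ) : ℝ :=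
  ∫ x, f x ∂μ.toJordanDecomposition.posPart - ∫ x, f x ∂μ.toJordanDecomposition.negPart

/-- The bilinear form `Z_A(μ,ν) = ∫∫ e^{-d(x,y)} dμ(x) dν(y)` on finite signed
Borel measures. -/
noncomputable def Zform {A : Type*} [MetricSpace A] [MeasurableSpace A]
    (μ ν : SignedMeasure A) : ℝ :=
  sInt μ (fun x => sInt ν (fun y => Real.exp (-dist x y)))

/-- A metric space is positive definite if every finite subspace has positive
definite similarity matrix `[e^{-d(x,y)}]`. -/
def PosDefSpace (A : Type*) [MetricSpace A] : Prop :=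
  ∀ s : Finset A, (Matrix.of fun x y : ↥s => Real.exp (-dist (x : A) (y : A))).PosDef

section helpers

variable {A : Type*} [MetricSpace A] [CompactSpace A] [MeasurableSpace A] [BorelSpace A]

lemma integrable_cont (p : Measure A) [IsFiniteMeasure p] {f : A → ℝ} (hf : Continuous f) :
    Integrable f p :=
  (BoundedContinuousFunction.mkOfCompact ⟨f, hf⟩).integrable p

lemma sInt_eq (μ : SignedMeasure A) (p n : Measure A) [IsFiniteMeasure p] [IsFiniteMeasure n]
    (h : μ = p.toSignedMeasure - n.toSignedMeasure) {f : A → ℝ} (hf : Continuous f) :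
    sInt μ f = ∫ x, f x ∂p - ∫ x, f x ∂n := by
  have h0 := μ.toSignedMeasure_toJordanDecomposition
  unfold JordanDecomposition.toSignedMeasure at h0
  unfold sInt
  set P := μ.toJordanDecomposition.posPart with hP
  set N := μ.toJordanDecomposition.negPart with hN
  have h1 : (P + n).toSignedMeasure = (p + N).toSignedMeasure := by
    rw [Measure.toSignedMeasure_add, Measure.toSignedMeasure_add]
    exact sub_eq_sub_iff_add_eq_add.1 (h0.trans h)
  have h2 : P + n = p + N := Measure.toSignedMeasure_eq_toSignedMeasure_iff.1 h1
  have h3 : ∫ x, f x ∂(P + n) = ∫ x, f x ∂(p + N) := by rw [h2]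
  rw [integral_add_measure (integrable_cont _ hf) (integrable_cont _ hf),
    integral_add_measure (integrable_cont _ hf) (integrable_cont _ hf)] at h3
  linarith

lemma sInt_add (μ ν : SignedMeasure A) {f : A → ℝ} (hf : Continuous f) :
    sInt (μ + ν) f = sInt μ f + sInt ν f := by
  have h1 := μ.toSignedMeasure_toJordanDecomposition
  have h2 := ν.toSignedMeasure_toJordanDecomposition
  unfold JordanDecomposition.toSignedMeasure at h1 h2
  rw [sInt_eq (μ + ν)
    (μ.toJordanDecomposition.posPart + ν.toJordanDecomposition.posPart)
    (μ.toJordanDecomposition.negPart + ν.toJordanDecomposition.negPart) _ hf]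
  · rw [integral_add_measure (integrable_cont _ hf) (integrable_cont _ hf),
      integral_add_measure (integrable_cont _ hf) (integrable_cont _ hf)]
    unfold sInt
    ring
  · rw [Measure.toSignedMeasure_add, Measure.toSignedMeasure_add]
    nth_rewrite 1 [← h1, ← h2]
    abel

lemma sInt_smul (c : ℝ) (μ : SignedMeasure A) (f : A → ℝ) :
    sInt (c • μ) f = c * sInt μ f := by
  unfold sInt
  rw [SignedMeasure.toJordanDecomposition_smul_real]
  rcases le_or_gt 0 c with hc | hc
  · rw [JordanDecomposition.real_smul_posPart_nonneg _ _ hc,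
      JordanDecomposition.real_smul_negPart_nonneg _ _ hc,
      integral_smul_nnreal_measure, integral_smul_nnreal_measure]
    simp only [NNReal.smul_def, Real.coe_toNNReal _ hc, smul_eq_mul]
    ring
  · rw [JordanDecomposition.real_smul_posPart_neg _ _ hc,
      JordanDecomposition.real_smul_negPart_neg _ _ hc,
      integral_smul_nnreal_measure, integral_smul_nnreal_measure]
    simp only [NNReal.smul_def, Real.coe_toNNReal _ (neg_pos.2 hc).le, smul_eq_mul]
    ring

lemma sInt_dirac (a : A) {f : A → ℝ} (hf : Continuous f) :
    sInt (Measure.dirac a).toSignedMeasure f = f a := by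
  rw [sInt_eq _ (Measure.dirac a) 0 (by simp) hf]
  simp

lemma sInt_lin (μ : SignedMeasure A) {f g : A → ℝ} (hf : Continuous f) (hg : Continuous g)
    (t : ℝ) : sInt μ (fun x => f x + t * g x) = sInt μ f + t * sInt μ g := by
  unfold sInt
  have hg' : Continuous fun x => t * g x := by fun_prop
  rw [integral_add (integrable_cont _ hf) (integrable_cont _ hg'),
    integral_add (integrable_cont _ hf) (integrable_cont _ hg'),
    integral_const_mul, integral_const_mul]
  ring

lemma cont_pot (μ : SignedMeasure A) :
    Continuous fun x => sInt μ (fun y => Real.exp (-dist x y)) := by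
  unfold sInt
  have key : ∀ (p : Measure A) [IsFiniteMeasure p],
      Continuous fun x => ∫ y, Real.exp (-dist x y) ∂p := by
    intro p _
    refine continuous_of_dominated (bound := fun _ => 1) ?_ ?_ (integrable_const _) ?_
    · intro x
      exact (integrable_cont p (by fun_prop)).aestronglyMeasurable
    · intro x
      refine Filter.Eventually.of_forall fun y => ?_
      rw [Real.norm_eq_abs, Real.abs_exp, Real.exp_le_one_iff]
      linarith [dist_nonneg (x := x) (y := y)]
    · refine Filter.Eventually.of_forall fun y => ?_
      fun_prop
  exact (key _).sub (key _)

lemma Zform_pert (μ : SignedMeasure A) (a : A) (t : ℝ) :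
    Zform (μ + t • (Measure.dirac a).toSignedMeasure) (μ + t • (Measure.dirac a).toSignedMeasure)
      = Zform μ μ + 2 * t * sInt μ (fun y => Real.exp (-dist a y)) + t ^ 2 := by
  have hk : ∀ x : A, Continuous fun y => Real.exp (-dist x y) := fun x => by fun_prop
  have hk' : Continuous fun x => Real.exp (-dist x a) := by fun_prop
  have e : (fun x => sInt (μ + t • (Measure.dirac a).toSignedMeasure)
      (fun y => Real.exp (-dist x y))) =
      fun x => sInt μ (fun y => Real.exp (-dist x y)) + t * Real.exp (-dist x a) := by
    funext x
    rw [sInt_add _ _ (hk x), sInt_smul, sInt_dirac _ (hk x)]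
  have hc := cont_pot μ
  have hsum : Continuous fun x => sInt μ (fun y => Real.exp (-dist x y)) +
      t * Real.exp (-dist x a) := hc.add (continuous_const.mul hk')
  unfold Zform
  rw [e, sInt_add _ _ hsum, sInt_smul, sInt_dirac _ hsum, sInt_lin _ hc hk']
  simp only [dist_self, neg_zero, Real.exp_zero, dist_comm _ a]
  ring

end helpers

theorem statement3 (A : Type*) [MetricSpace A] [CompactSpace A]
    [MeasurableSpace A] [BorelSpace A] (hA : PosDefSpace A)
    (μ : SignedMeasure A) (hμ : Zform μ μ ≠ 0)
    (hmax : ∀ ν : SignedMeasure A, Zform ν ν ≠ 0 →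
      (ν Set.univ) ^ 2 / Zform ν ν ≤ (μ Set.univ) ^ 2 / Zform μ μ) :
    ∃ c : ℝ, c ≠ 0 ∧
      ∀ x : A, sInt (c • μ) (fun y => Real.exp (-dist x y)) = 1 := by
  rcases isEmpty_or_nonempty A with hE | ⟨⟨a₀⟩⟩
  · exact ⟨1, one_ne_zero, fun x => (hE.false x).elim⟩
  set m := μ Set.univ with hm
  set Z := Zform μ μ with hZ
  have h1 : 1 ≤ m ^ 2 / Z := by
    have hz := Zform_pert (0 : SignedMeasure A) a₀ 1
    have h0' : ∀ f : A → ℝ, sInt (0 : SignedMeasure A) f = 0 := fun f => by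
      simpa using sInt_smul 0 (0 : SignedMeasure A) f
    have h0 : Zform (0 : SignedMeasure A) 0 = 0 := h0' _
    rw [h0, h0'] at hz
    simp only [zero_add, one_smul] at hz
    have := hmax (Measure.dirac a₀).toSignedMeasure (by rw [hz]; norm_num)
    rw [hz] at this
    simpa [Measure.toSignedMeasure_apply_measurable] using this
  have hZpos : 0 < Z := by
    by_contra hn
    have : m ^ 2 / Z ≤ 0 := div_nonpos_of_nonneg_of_nonpos (sq_nonneg _) (not_lt.1 hn)
    linarith
  have hm0 : m ≠ 0 := by
    intro h
    rw [h] at h1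
    norm_num at h1
  refine ⟨m / Z, div_ne_zero hm0 hμ, fun x => ?_⟩
  rw [sInt_smul]
  set H := sInt μ (fun y => Real.exp (-dist x y)) with hH
  -- the first-order condition
  have hev : ∀ᶠ t : ℝ in nhds 0, 0 < Z + 2 * t * H + t ^ 2 := by
    have hc : Continuous fun t : ℝ => Z + 2 * t * H + t ^ 2 := by fun_prop
    exact hc.continuousAt.eventually (lt_mem_nhds (by simpa using hZpos))
  have hmin : IsLocalMin (fun t : ℝ => m ^ 2 * (Z + 2 * t * H + t ^ 2) - (m + t) ^ 2 * Z) 0 := by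
    filter_upwards [hev] with t ht
    have hz := Zform_pert μ x t
    have hle := hmax (μ + t • (Measure.dirac x).toSignedMeasure) (by rw [hz]; exact ht.ne')
    rw [hz] at hle
    have hu : (μ + t • (Measure.dirac x).toSignedMeasure) Set.univ = m + t := by
      simp [Measure.toSignedMeasure_apply_measurable, hm]
    rw [hu, div_le_div_iff₀ ht hZpos] at hle
    nlinarith
  have hd : HasDerivAt (fun t : ℝ => m ^ 2 * (Z + 2 * t * H + t ^ 2) - (m + t) ^ 2 * Z)
      (m ^ 2 * (2 * H) - 2 * m * Z) 0 := by
    have i := hasDerivAt_id (0 : ℝ)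
    have := (((((i.const_mul 2).mul_const H).const_add Z).add (i.pow 2)).const_mul (m ^ 2)).sub
      (((i.const_add m).pow 2).mul_const Z)
    have e : m ^ 2 * (2 * H) - 2 * m * Z = m ^ 2 * (2 * 1 * H + ((2 : ℕ) : ℝ) * id 0 ^ (2 - 1) * 1)
        - ((2 : ℕ) : ℝ) * (m + id 0) ^ (2 - 1) * 1 * Z := by
      simp
    rw [e]
    exact this
  have h0 := hmin.hasDerivAt_eq_zero hd
  have h2 : m * H = Z := by
    have : m * (m * H - Z) = 0 := by linarith
    rcases mul_eq_zero.1 this with h | h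
    · exact absurd h hm0
    · linarith
  rw [div_mul_eq_mul_div, h2, div_self hμ]
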